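/- arXiv:1910.10742 — 3 statements merged into one kernel-verified Lean document; each statement's English description precedes it below -/
import Mathlib

section
/- Let π be a group, Λ a normal subgroup of π, and G a group. Let ρ : Λ → G be a group homomorphism such that the only element g ∈ G commuting with every element of the image ρ(Λ) is the identity. Suppose that for every t ∈ π there exists g ∈ G with ρ(t a t⁻¹) = g · ρ(a) · g⁻¹ for all a ∈ Λ. Then there exists a group homomorphism ρ̃ : π → G whose restriction to Λ equals ρ. -/
/-- Lemma 2.1 (converse half): a homomorphism `ρ : N → G` with trivial centralizer of its
image, whose conjugacy class is fixed by the outer conjugation action of `π`, extends to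
a homomorphism of `π`. -/
theorem extension_of_fixed_representation
    {π G : Type*} [Group π] [Group G] (N : Subgroup π) (hN : N.Normal)
    (ρ : N →* G)
    (hcent : ∀ g : G, (∀ a : N, g * ρ a = ρ a * g) → g = 1)
    (hfix : ∀ t : π, ∃ g : G, ∀ a : N,
      ρ ⟨t * (a : π) * t⁻¹, hN.conj_mem a a.2 t⟩ = g * ρ a * g⁻¹) :
    ∃ ρt : π →* G, ∀ a : N, ρt a = ρ a := by
  choose S hS using hfix
  have conj_unique : ∀ g h : G, (∀ a : N, g * ρ a * g⁻¹ = h * ρ a * h⁻¹) → g = h := by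
    intro g h hgh
    refine (inv_mul_eq_one.mp (hcent (h⁻¹ * g) fun a => ?_)).symm
    calc h⁻¹ * g * ρ a = h⁻¹ * (g * ρ a * g⁻¹) * g := by group
      _ = h⁻¹ * (h * ρ a * h⁻¹) * g := by rw [hgh a]
      _ = ρ a * (h⁻¹ * g) := by group
  refine ⟨MonoidHom.mk' S fun s t => conj_unique _ _ fun a => ?_,
    fun b => conj_unique _ _ fun a => ?_⟩
  · calc S (s * t) * ρ a * (S (s * t))⁻¹
        = ρ ⟨s * t * (a : π) * (s * t)⁻¹, hN.conj_mem a a.2 (s * t)⟩ := (hS (s * t) a).symm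
      _ = ρ ⟨s * (t * (a : π) * t⁻¹) * s⁻¹, hN.conj_mem _ (hN.conj_mem a a.2 t) s⟩ := by
        congr 2
        group
      _ = S s * (S t * ρ a * (S t)⁻¹) * (S s)⁻¹ := by
        rw [← hS t a]
        exact hS s ⟨t * (a : π) * t⁻¹, hN.conj_mem a a.2 t⟩
      _ = S s * S t * ρ a * (S s * S t)⁻¹ := by group
  · rw [MonoidHom.mk'_apply, ← hS, ← map_inv, ← map_mul, ← map_mul]
    rfl
end

section
/- For all z₁, z₂, z₃ ∈ ℂˣ, the class of (z₁, z₂, z₃) is fixed by both α and β — that is, each of the triples (z₁, z₂⁻¹, z₃⁻¹) and (z₁⁻¹, z₂, z₃⁻¹) is equal either to (z₁, z₂, z₃) or to (z₁⁻¹, z₂⁻¹, z₃⁻¹) — if and only if at least two of the three conditions z₁² = 1, z₂² = 1, z₃² = 1 hold. -/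
theorem eq_inv_iff_sq_eq_one {G : Type*} [Group G] (z : G) : z = z⁻¹ ↔ z ^ 2 = 1 := by
  rw [eq_inv_iff_mul_eq_one, pow_two]

/-- Fix(𝕂) for the 𝕂 = ℤ/2 × ℤ/2 action on Char(ℤ³, SL(2,ℂ)) ≅ (ℂˣ)³/(simultaneous
inversion): the class of `(z₁, z₂, z₃)` is fixed by both `α` and `β` iff at least two of
`z₁² = 1`, `z₂² = 1`, `z₃² = 1` hold (a bouquet of three complex lines). -/
theorem fix_klein_four_character_variety (z₁ z₂ z₃ : ℂˣ) :
    (((z₁, z₂⁻¹, z₃⁻¹) = (z₁, z₂, z₃) ∨ (z₁, z₂⁻¹, z₃⁻¹) = (z₁⁻¹, z₂⁻¹, z₃⁻¹)) ∧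
     ((z₁⁻¹, z₂, z₃⁻¹) = (z₁, z₂, z₃) ∨ (z₁⁻¹, z₂, z₃⁻¹) = (z₁⁻¹, z₂⁻¹, z₃⁻¹))) ↔
      ((z₁ ^ 2 = 1 ∧ z₂ ^ 2 = 1) ∨ (z₁ ^ 2 = 1 ∧ z₃ ^ 2 = 1) ∨
        (z₂ ^ 2 = 1 ∧ z₃ ^ 2 = 1)) := by
  simp only [Prod.mk.injEq, true_and, and_true, eq_comm (a := z₁⁻¹) (b := z₁),
    eq_comm (a := z₂⁻¹) (b := z₂), eq_comm (a := z₃⁻¹) (b := z₃), eq_inv_iff_sq_eq_one]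
  tauto
end

section
/- Define affine isometries x and y of ℝ³ by x(v₁,v₂,v₃) = (v₁ + 1/2, −v₂, −v₃) and y(v₁,v₂,v₃) = (−v₁, v₂ + 1/2, 1/2 − v₃), and let Π be the subgroup of the group of affine isometries of ℝ³ generated by x and y. Then for every w ∈ ℂˣ there exists a group homomorphism φ : Π → SL(2,ℂ) with φ(x) = [[w, 0], [0, w⁻¹]] and φ(y) = [[0, 1], [−1, 0]]. -/
/-- Pairs of an isometry of `ℝ³` with holonomy in `{±1}³ ∩ SO(3)`, whose translation part is
(half-)integral as in the Hantzsche–Wendt group, and the matrix assigned to it. The two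
constructors distinguish whether the first coordinate axis is preserved or reversed. -/
inductive HantzscheWendtPair (w : ℂ) :
    (EuclideanSpace ℝ (Fin 3) ≃ᵃⁱ[ℝ] EuclideanSpace ℝ (Fin 3)) ×
      Matrix.SpecialLinearGroup (Fin 2) ℂ → Prop
  | preserving (g : EuclideanSpace ℝ (Fin 3) ≃ᵃⁱ[ℝ] EuclideanSpace ℝ (Fin 3))
      (M : Matrix.SpecialLinearGroup (Fin 2) ℂ) (f a m n : ℤ) (hf : f = 1 ∨ f = -1)
      (h0 : ∀ v, g v 0 = v 0 + a / 2) (h1 : ∀ v, g v 1 = f * v 1 + m)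
      (h2 : ∀ v, g v 2 = f * v 2 + n)
      (hM : M.1 = !![(-1) ^ (m + n) * w ^ a, 0; 0, (-1) ^ (m + n) * w ^ (-a)]) :
      HantzscheWendtPair w (g, M)
  | reversing (g : EuclideanSpace ℝ (Fin 3) ≃ᵃⁱ[ℝ] EuclideanSpace ℝ (Fin 3))
      (M : Matrix.SpecialLinearGroup (Fin 2) ℂ) (f a m n : ℤ) (hf : f = 1 ∨ f = -1)
      (h0 : ∀ v, g v 0 = -v 0 + a / 2) (h1 : ∀ v, g v 1 = f * v 1 + m + 1 / 2)
      (h2 : ∀ v, g v 2 = -f * v 2 + n + 1 / 2)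
      (hM : M.1 = !![0, (-1) ^ (m + n) * w ^ a; -((-1) ^ (m + n) * w ^ (-a)), 0]) :
      HantzscheWendtPair w (g, M)

namespace HantzscheWendtPair

variable {w : ℂ}

lemma inv_neg_one_zpow (k : ℤ) : ((-1 : ℂ) ^ k)⁻¹ = (-1) ^ k := by
  rw [← inv_zpow, inv_neg_one]

protected lemma one : HantzscheWendtPair w 1 := by
  refine preserving 1 1 1 0 0 0 (Or.inl rfl) ?_ ?_ ?_ ?_
  · simp
  · simp
  · simp
  · simp [Matrix.one_fin_two]

protected lemma mul (hw : w ≠ 0)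
    {p q : (EuclideanSpace ℝ (Fin 3) ≃ᵃⁱ[ℝ] EuclideanSpace ℝ (Fin 3)) ×
      Matrix.SpecialLinearGroup (Fin 2) ℂ}
    (hp : HantzscheWendtPair w p) (hq : HantzscheWendtPair w q) :
    HantzscheWendtPair w (p * q) := by
  have h_neg : (-1 : ℂ) ≠ 0 := by norm_num
  obtain ⟨g, M, f, a, m, n, hf, h0, h1, h2, hM⟩ | ⟨g, M, f, a, m, n, hf, h0, h1, h2, hM⟩ := hp <;>
  obtain ⟨g', M', f', a', m', n', hf', h0', h1', h2', hM'⟩ |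
    ⟨g', M', f', a', m', n', hf', h0', h1', h2', hM'⟩ := hq
  · refine preserving (g * g') (M * M') (f * f') (a + a') (m + f * m') (n + f * n') ?_ ?_ ?_ ?_ ?_
    · rcases hf with rfl | rfl <;> rcases hf' with rfl | rfl <;> simp
    · intro v; simp only [AffineIsometryEquiv.coe_mul, Function.comp_apply, h0, h0']; push_cast; ring
    · intro v; simp only [AffineIsometryEquiv.coe_mul, Function.comp_apply, h1, h1']; push_cast; ring
    · intro v; simp only [AffineIsometryEquiv.coe_mul, Function.comp_apply, h2, h2']; push_cast; ring
    · rw [Matrix.SpecialLinearGroup.coe_mul, hM, hM']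
      rcases hf with rfl | rfl <;> ext i j <;> fin_cases i <;> fin_cases j <;>
        simp [zpow_add₀ h_neg, zpow_add₀ hw, inv_neg_one_zpow] <;> ring
  · refine reversing (g * g') (M * M') (f * f') (a + a') (m + f * m' + (f - 1) / 2)
      (n + f * n' + (f - 1) / 2) ?_ ?_ ?_ ?_ ?_
    · rcases hf with rfl | rfl <;> rcases hf' with rfl | rfl <;> simp
    · intro v; simp only [AffineIsometryEquiv.coe_mul, Function.comp_apply, h0, h0']; push_cast; ring
    · intro v; simp only [AffineIsometryEquiv.coe_mul, Function.comp_apply, h1, h1']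
      rcases hf with rfl | rfl <;> norm_num <;> ring
    · intro v; simp only [AffineIsometryEquiv.coe_mul, Function.comp_apply, h2, h2']
      rcases hf with rfl | rfl <;> norm_num <;> ring
    · rw [Matrix.SpecialLinearGroup.coe_mul, hM, hM']
      rcases hf with rfl | rfl <;> ext i j <;> fin_cases i <;> fin_cases j <;>
        simp [zpow_add₀ h_neg, zpow_add₀ hw, inv_neg_one_zpow] <;> ring
  · refine reversing (g * g') (M * M') (f * f') (a - a') (m + f * m') (n - f * n') ?_ ?_ ?_ ?_ ?_
    · rcases hf with rfl | rfl <;> rcases hf' with rfl | rfl <;> simp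
    · intro v; simp only [AffineIsometryEquiv.coe_mul, Function.comp_apply, h0, h0']; push_cast; ring
    · intro v; simp only [AffineIsometryEquiv.coe_mul, Function.comp_apply, h1, h1']; push_cast; ring
    · intro v; simp only [AffineIsometryEquiv.coe_mul, Function.comp_apply, h2, h2']; push_cast; ring
    · rw [Matrix.SpecialLinearGroup.coe_mul, hM, hM']
      rcases hf with rfl | rfl <;> ext i j <;> fin_cases i <;> fin_cases j <;>
        simp [zpow_add₀ h_neg, zpow_sub₀ h_neg, zpow_sub₀ hw, inv_neg_one_zpow,
          div_eq_mul_inv] <;> ring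
  · refine preserving (g * g') (M * M') (f * f') (a - a') (m + f * m' + (f + 1) / 2)
      (n - f * n' + (1 - f) / 2) ?_ ?_ ?_ ?_ ?_
    · rcases hf with rfl | rfl <;> rcases hf' with rfl | rfl <;> simp
    · intro v; simp only [AffineIsometryEquiv.coe_mul, Function.comp_apply, h0, h0']; push_cast; ring
    · intro v; simp only [AffineIsometryEquiv.coe_mul, Function.comp_apply, h1, h1']
      rcases hf with rfl | rfl <;> norm_num <;> ring
    · intro v; simp only [AffineIsometryEquiv.coe_mul, Function.comp_apply, h2, h2']
      rcases hf with rfl | rfl <;> norm_num <;> ring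
    · rw [Matrix.SpecialLinearGroup.coe_mul, hM, hM']
      rcases hf with rfl | rfl <;> ext i j <;> fin_cases i <;> fin_cases j <;>
        simp [zpow_add₀ h_neg, zpow_sub₀ h_neg, zpow_sub₀ hw, inv_neg_one_zpow,
          div_eq_mul_inv] <;> ring

lemma eq_one {M : Matrix.SpecialLinearGroup (Fin 2) ℂ} (h : HantzscheWendtPair w (1, M)) :
    M = 1 := by
  obtain ⟨_, _, f, a, m, n, hf, h0, h1, h2, hM⟩ | ⟨_, _, f, a, m, n, hf, h0, h1, h2, hM⟩ := h
  · obtain rfl : a = 0 := by simpa using (h0 0).symm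
    obtain rfl : m = 0 := by simpa using (h1 0).symm
    obtain rfl : n = 0 := by simpa using (h2 0).symm
    exact Subtype.ext (by simp [hM, Matrix.one_fin_two])
  · have h : (0 : ℝ) = m + 1 / 2 := by simpa using h1 0
    have h' : (2 * m + 1 : ℤ) = 0 := by
      have : (2 * m + 1 : ℝ) = 0 := by linarith
      exact_mod_cast this
    omega

protected lemma inv
    {p : (EuclideanSpace ℝ (Fin 3) ≃ᵃⁱ[ℝ] EuclideanSpace ℝ (Fin 3)) ×
      Matrix.SpecialLinearGroup (Fin 2) ℂ}
    (hp : HantzscheWendtPair w p) : HantzscheWendtPair w p⁻¹ := by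
  have h_neg : (-1 : ℂ) ≠ 0 := by norm_num
  obtain ⟨g, M, f, a, m, n, hf, h0, h1, h2, hM⟩ | ⟨g, M, f, a, m, n, hf, h0, h1, h2, hM⟩ := hp <;>
  have hg (v) : g (g⁻¹ v) = v := g.apply_symm_apply v
  · refine preserving g⁻¹ M⁻¹ f (-a) (-(f * m)) (-(f * n)) hf ?_ ?_ ?_ ?_
    · intro v; have := h0 (g⁻¹ v); rw [hg] at this; push_cast; linarith
    · intro v; have := h1 (g⁻¹ v); rw [hg] at this
      rcases hf with rfl | rfl <;> push_cast at this ⊢ <;> linarith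
    · intro v; have := h2 (g⁻¹ v); rw [hg] at this
      rcases hf with rfl | rfl <;> push_cast at this ⊢ <;> linarith
    · rw [Matrix.SpecialLinearGroup.coe_inv, hM, Matrix.adjugate_fin_two_of]
      rcases hf with rfl | rfl <;> ext i j <;> fin_cases i <;> fin_cases j <;>
        simp [zpow_add₀ h_neg, inv_neg_one_zpow]
  · refine reversing g⁻¹ M⁻¹ f a (-(f * m) - (f + 1) / 2) (f * n + (f - 1) / 2) hf ?_ ?_ ?_ ?_
    · intro v; have := h0 (g⁻¹ v); rw [hg] at this; linarith
    · intro v; have := h1 (g⁻¹ v); rw [hg] at this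
      rcases hf with rfl | rfl <;> norm_num at this ⊢ <;> linarith
    · intro v; have := h2 (g⁻¹ v); rw [hg] at this
      rcases hf with rfl | rfl <;> norm_num at this ⊢ <;> linarith
    · rw [Matrix.SpecialLinearGroup.coe_inv, hM, Matrix.adjugate_fin_two_of]
      rcases hf with rfl | rfl <;> ext i j <;> fin_cases i <;> fin_cases j <;>
        simp [zpow_add₀ h_neg, zpow_sub₀ h_neg, inv_neg_one_zpow] <;> ring

end HantzscheWendtPair

/-- The pairs of `HantzscheWendtPair` form a subgroup. -/
def hantzscheWendtGraph {w : ℂ} (hw : w ≠ 0) :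
    Subgroup ((EuclideanSpace ℝ (Fin 3) ≃ᵃⁱ[ℝ] EuclideanSpace ℝ (Fin 3)) ×
      Matrix.SpecialLinearGroup (Fin 2) ℂ) where
  carrier := {p | HantzscheWendtPair w p}
  mul_mem' := HantzscheWendtPair.mul hw
  one_mem' := HantzscheWendtPair.one
  inv_mem' := HantzscheWendtPair.inv

/-- A subgroup of `G × H` that meets `{1} × H` trivially induces a homomorphism on every subgroup
of its projection to `G`. -/
lemma Subgroup.exists_monoidHom_of_graph {G H : Type*} [Group G] [Group H] (S : Subgroup (G × H))
    (hS : ∀ h : H, (1, h) ∈ S → h = 1) (K : Subgroup G)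
    (hK : K ≤ S.map (MonoidHom.fst G H)) :
    ∃ φ : K →* H, ∀ (k : K) (h : H), ((k : G), h) ∈ S → φ k = h := by
  have inj : Function.Injective ((MonoidHom.fst G H).comp S.subtype) := by
    rw [injective_iff_map_eq_one]
    rintro ⟨⟨g, h⟩, hp⟩ (rfl : g = 1)
    simp [hS h hp]
  have hK' : K ≤ ((MonoidHom.fst G H).comp S.subtype).range := by
    rwa [MonoidHom.range_comp, Subgroup.range_subtype]
  refine ⟨((MonoidHom.snd G H).comp S.subtype).comp
    ((MonoidHom.ofInjective inj).symm.toMonoidHom.comp (Subgroup.inclusion hK')), ?_⟩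
  intro k h hkh
  have : (MonoidHom.ofInjective inj).symm (Subgroup.inclusion hK' k) = ⟨(k, h), hkh⟩ := by
    rw [MulEquiv.symm_apply_eq]
    rfl
  simp [this]

/-- Section 5.2: for every nonzero `w ∈ ℂ` there is a homomorphism from the
Hantzsche–Wendt group — the subgroup of affine isometries of ℝ³ generated by
`x(v) = (v₁ + 1/2, −v₂, −v₃)` and `y(v) = (−v₁, v₂ + 1/2, 1/2 − v₃)` — to SL(2,ℂ)
sending `x` to `diag(w, w⁻¹)` and `y` to `[[0,1],[−1,0]]`. -/
theorem hantzsche_wendt_group_SL2C_representation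
    (x y : EuclideanSpace ℝ (Fin 3) ≃ᵃⁱ[ℝ] EuclideanSpace ℝ (Fin 3))
    (hx : ∀ v : EuclideanSpace ℝ (Fin 3),
      x v = (EuclideanSpace.equiv (Fin 3) ℝ).symm ![v 0 + 1 / 2, -(v 1), -(v 2)])
    (hy : ∀ v : EuclideanSpace ℝ (Fin 3),
      y v = (EuclideanSpace.equiv (Fin 3) ℝ).symm ![-(v 0), v 1 + 1 / 2, 1 / 2 - v 2])
    (w : ℂ) (hw : w ≠ 0) :
    ∃ φ : Subgroup.closure {x, y} →* Matrix.SpecialLinearGroup (Fin 2) ℂ,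
      φ ⟨x, Subgroup.subset_closure (by simp)⟩ =
        ⟨!![w, 0; 0, w⁻¹], by simp [Matrix.det_fin_two_of, mul_inv_cancel₀ hw]⟩ ∧
      φ ⟨y, Subgroup.subset_closure (by simp)⟩ =
        ⟨!![0, 1; -1, 0], by norm_num [Matrix.det_fin_two_of]⟩ := by
  have hxS : HantzscheWendtPair w (x, ⟨!![w, 0; 0, w⁻¹],
      by simp [Matrix.det_fin_two_of, mul_inv_cancel₀ hw]⟩) := by
    refine .preserving _ _ (-1) 1 0 0 (Or.inr rfl) ?_ ?_ ?_ ?_ <;> simp [hx]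
  have hyS : HantzscheWendtPair w (y, ⟨!![0, 1; -1, 0],
      by norm_num [Matrix.det_fin_two_of]⟩) := by
    refine .reversing _ _ 1 0 0 0 (Or.inl rfl) ?_ ?_ ?_ ?_ <;> simp [hy, neg_add_eq_sub]
  obtain ⟨φ, hφ⟩ := (hantzscheWendtGraph hw).exists_monoidHom_of_graph
    (fun _ h ↦ HantzscheWendtPair.eq_one h) (Subgroup.closure {x, y}) (by
      rw [Subgroup.closure_le]
      rintro g (rfl | rfl)
      · exact ⟨_, hxS, rfl⟩
      · exact ⟨_, hyS, rfl⟩)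
  exact ⟨φ, hφ _ _ hxS, hφ _ _ hyS⟩
end
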